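/- arXiv:1910.13554 — 8 statements merged into one kernel-verified Lean document; each statement's English description precedes it below -/
import Mathlib

section
/- State transformers satisfy the left star induction law: for all f, g, h : S → Set S, if g ≤ h and f ∘K h ≤ h, then f* ∘K g ≤ h. -/
/-- Kleisli composition of state transformers. -/
def kcomp {S : Type*} (f g : S → Set S) : S → Set S :=
  fun s => ⋃ s' ∈ f s, g s'

/-- Kleisli unit. -/
def eta {S : Type*} : S → Set S := fun s => {s}

/-- Kleisli powers. -/
def kpow {S : Type*} (f : S → Set S) : ℕ → S → Set S
  | 0 => eta
  | n + 1 => kcomp f (kpow f n)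

/-- Kleene star of a state transformer. -/
def kstar {S : Type*} (f : S → Set S) : S → Set S :=
  fun s => ⋃ n, kpow f n s

/-- Embedding of a predicate as a test. -/
def test {S : Type*} (P : S → Prop) : S → Set S :=
  fun s => {s' | s' = s ∧ P s}

/-- Hoare triple in the state transformer model. -/
def hoare {S : Type*} (P : S → Prop) (f : S → Set S) (Q : S → Prop) : Prop :=
  ∀ s, P s → f s ⊆ {s' | Q s'}

/-- Morgan's specification statement. -/
def spec {S : Type*} (P Q : S → Prop) : S → Set S :=
  fun s => {s' | P s → Q s'}

/-- Assignment as a state transformer. -/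
def assign {V A : Type*} [DecidableEq V] (x : V) (e : (V → A) → A) :
    (V → A) → Set (V → A) :=
  fun s => {Function.update s x (e s)}

/-- Kleisli powers satisfy left induction: the finite form of the star induction law. -/
theorem kcomp_kpow_le {S : Type*} {f g h : S → Set S} (hg : g ≤ h) (hf : kcomp f h ≤ h)
    (n : ℕ) : kcomp (kpow f n) g ≤ h := by
  induction n with
  | zero =>
    intro s t ht
    simp only [kcomp, kpow, eta, Set.mem_singleton_iff, Set.iUnion_iUnion_eq_left] at ht
    exact hg s ht
  | succ n ih =>
    intro s t ht
    simp only [kcomp, kpow, Set.mem_iUnion, exists_prop] at ht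
    obtain ⟨v, ⟨u, hu, hv⟩, ht⟩ := ht
    exact hf s (Set.mem_biUnion hu (ih u (Set.mem_biUnion hv ht)))

/-- Left star induction law. -/
theorem kstar_inductl {S : Type*} (f g h : S → Set S)
    (hg : g ≤ h) (hf : kcomp f h ≤ h) : kcomp (kstar f) g ≤ h := by
  intro s t ht
  simp only [kcomp, kstar, Set.mem_iUnion, exists_prop] at ht
  obtain ⟨u, ⟨n, hu⟩, ht⟩ := ht
  exact kcomp_kpow_le hg hf n s (Set.mem_biUnion hu ht)
end

section
/- State transformers satisfy the right (opposite) star induction law: for all f, g, h : S → Set S, if g ≤ h and h ∘K f ≤ h, then g ∘K f* ≤ h. -/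
/-- If `h` absorbs `f` on the right, it absorbs every Kleisli power of `f`. -/
theorem kpow_subset_of_kcomp_le {S : Type*} {f h : S → Set S} (hf : kcomp h f ≤ h)
    {s : S} (n : ℕ) : ∀ s' ∈ h s, kpow f n s' ⊆ h s := by
  induction n with
  | zero => exact fun s' hs' => Set.singleton_subset_iff.2 hs'
  | succ n ih =>
    exact fun s' hs' => Set.iUnion₂_subset fun t ht =>
      ih t (hf s (Set.mem_biUnion hs' ht))

/-- Right (opposite) star induction law. -/
theorem kstar_inductr {S : Type*} (f g h : S → Set S)
    (hg : g ≤ h) (hf : kcomp h f ≤ h) : kcomp g (kstar f) ≤ h := by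
  exact fun s => Set.iUnion₂_subset fun s' hs' => Set.iUnion_subset fun n =>
    kpow_subset_of_kcomp_le hf n s' (hg s hs')
end

section
/- For predicates P, Q : S → Prop and a state transformer f : S → Set S, the following are equivalent: (i) the Hoare triple {P} f {Q} holds; (ii) ⌈P⌉ ∘K f ≤ f ∘K ⌈Q⌉; (iii) ⌈P⌉ ∘K f ∘K ⌈λ s, ¬ Q s⌉ is the constant empty transformer λ s, ∅; (iv) ⌈P⌉ ∘K f = ⌈P⌉ ∘K f ∘K ⌈Q⌉. -/
theorem mem_kcomp {S : Type*} {f g : S → Set S} {s t : S} :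
    t ∈ kcomp f g s ↔ ∃ u ∈ f s, t ∈ g u := by
  simp [kcomp]

theorem mem_test {S : Type*} {P : S → Prop} {s t : S} : t ∈ test P s ↔ t = s ∧ P s :=
  Iff.rfl

theorem mem_test_kcomp {S : Type*} {P : S → Prop} {f : S → Set S} {s t : S} :
    t ∈ kcomp (test P) f s ↔ P s ∧ t ∈ f s := by
  simp only [mem_kcomp, mem_test]
  grind

theorem mem_kcomp_test {S : Type*} {Q : S → Prop} {f : S → Set S} {s t : S} :
    t ∈ kcomp f (test Q) s ↔ t ∈ f s ∧ Q t := by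
  simp only [mem_kcomp, mem_test]
  grind

/-- Algebraic characterisations of validity of Hoare triples. -/
theorem hoare_characterisations {S : Type*} (P Q : S → Prop) (f : S → Set S) :
    (hoare P f Q ↔ kcomp (test P) f ≤ kcomp f (test Q)) ∧
    (hoare P f Q ↔ kcomp (test P) (kcomp f (test (fun s => ¬ Q s))) = fun _ => (∅ : Set S)) ∧
    (hoare P f Q ↔ kcomp (test P) f = kcomp (test P) (kcomp f (test Q))) := by
  refine ⟨?_, ?_, ?_⟩
  · simp only [hoare, Pi.le_def, Set.subset_def, mem_test_kcomp,
      mem_kcomp_test, Set.mem_ofPred_eq]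
    grind
  · simp only [hoare, funext_iff, Set.ext_iff, Set.subset_def, mem_test_kcomp,
      mem_kcomp_test, Set.mem_ofPred_eq, Set.mem_empty_iff_false]
    grind
  · simp only [hoare, funext_iff, Set.ext_iff, Set.subset_def, mem_test_kcomp,
      mem_kcomp_test, Set.mem_ofPred_eq]
    grind
end

section
/- Hoare rule for while loops: for predicates T, P : S → Prop and a state transformer f : S → Set S, if the Hoare triple {λ s, T s ∧ P s} f {P} holds, then {P} (WHILE T DO f) {λ s, ¬ T s ∧ P s} holds, where WHILE T DO f = (⌈T⌉ ∘K f)* ∘K ⌈λ s, ¬ T s⌉. -/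
theorem hoare_eta {S : Type*} (P : S → Prop) : hoare P eta P := by
  rintro s hs _ rfl
  exact hs

theorem hoare_kcomp {S : Type*} {P Q R : S → Prop} {f g : S → Set S}
    (hf : hoare P f Q) (hg : hoare Q g R) : hoare P (kcomp f g) R :=
  fun s hs => Set.iUnion₂_subset fun s' hs' => hg s' (hf s hs hs')

theorem hoare_test {S : Type*} (T P : S → Prop) :
    hoare P (test T) (fun s => T s ∧ P s) := by
  rintro s hs _ ⟨rfl, hT⟩
  exact ⟨hT, hs⟩

theorem hoare_kpow {S : Type*} {P : S → Prop} {f : S → Set S}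
    (hf : hoare P f P) (n : ℕ) : hoare P (kpow f n) P := by
  induction n with
  | zero => exact hoare_eta P
  | succ n ih => exact hoare_kcomp hf ih

theorem hoare_kstar {S : Type*} {P : S → Prop} {f : S → Set S}
    (hf : hoare P f P) : hoare P (kstar f) P :=
  fun s hs => Set.iUnion_subset fun n => hoare_kpow hf n s hs

/-- Hoare rule for while loops (h-while). -/
theorem hoare_while {S : Type*} (T P : S → Prop) (f : S → Set S)
    (hf : hoare (fun s => T s ∧ P s) f P) :
    hoare P (kcomp (kstar (kcomp (test T) f)) (test (fun s => ¬ T s)))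
      (fun s => ¬ T s ∧ P s) :=
  hoare_kcomp (hoare_kstar (hoare_kcomp (hoare_test T P) hf)) (hoare_test _ P)
end

section
/- Refinement law for while loops (r-while): for predicates T, P : S → Prop, WHILE T DO [λ s, T s ∧ P s, P] ≤ [P, λ s, ¬ T s ∧ P s], where WHILE T DO f = (⌈T⌉ ∘K f)* ∘K ⌈λ s, ¬ T s⌉. -/
theorem kpow_preserves {S : Type*} {f : S → Set S} {P : S → Prop}
    (hf : hoare P f P) (n : ℕ) : hoare P (kpow f n) P := by
  induction n with
  | zero =>
    rintro s hs _ rfl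
    exact hs
  | succ n ih =>
    intro s hs s' h
    obtain ⟨t, ht, hs'⟩ := Set.mem_iUnion₂.1 h
    exact ih t (hf s hs ht) hs'

theorem kstar_preserves {S : Type*} {f : S → Set S} {P : S → Prop}
    (hf : hoare P f P) : hoare P (kstar f) P :=
  fun s hs => Set.iUnion_subset fun n => kpow_preserves hf n s hs

theorem hoare_test_kcomp_spec {S : Type*} (T P : S → Prop) :
    hoare P (kcomp (test T) (spec (fun s => T s ∧ P s) P)) P := by
  intro s hs s' h
  obtain ⟨_, ⟨rfl, hT⟩, hs'⟩ := Set.mem_iUnion₂.1 h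
  exact hs' ⟨hT, hs⟩

/-- Refinement law for while loops (r-while). -/
theorem r_while {S : Type*} (T P : S → Prop) :
    kcomp (kstar (kcomp (test T) (spec (fun s => T s ∧ P s) P)))
        (test (fun s => ¬ T s))
      ≤ spec P (fun s => ¬ T s ∧ P s) := by
  intro s s' h hs
  obtain ⟨_, ht, rfl, hT⟩ := Set.mem_iUnion₂.1 h
  exact ⟨hT, kstar_preserves (hoare_test_kcomp_spec T P) s hs ht⟩
end

section
/- Hoare rule for evolution commands (h-evl): let E = EuclideanSpace ℝ (Fin n), let f : E → E be Lipschitz continuous, let T ⊆ ℝ be an open interval with 0 ∈ T, and let φ : ℝ → E → E be a flow for f on T, i.e. for every s ∈ E, φ 0 s = s and for every t ∈ T, the map τ ↦ φ τ s has derivative f (φ t s) at t. Let U ⊆ T with 0 ∈ U and U an interval, and let G, Q : E → Prop. If a state s satisfies: for all t ∈ U, (for all τ ∈ U with τ ≤ t, G (φ τ s)) implies Q (φ t s), then for every X ∈ Sols f U s and every t ∈ U, (for all τ ∈ U with τ ≤ t, G (X τ)) implies Q (X t). Equivalently, the Hoare triple {λ s, ∀ t ∈ U, (∀ τ ∈ U,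 τ ≤ t → G (φ τ s)) → Q (φ t s)} (x' = f & G on U) {Q} holds, where the evolution command denotes the guarded orbital γ. -/
/-- Solutions of the initial value problem for vector field `f` on time domain `U`
with initial state `s`. -/
def Sols {n : ℕ} (f : EuclideanSpace ℝ (Fin n) → EuclideanSpace ℝ (Fin n))
    (U : Set ℝ) (s : EuclideanSpace ℝ (Fin n)) : Set (ℝ → EuclideanSpace ℝ (Fin n)) :=
  {X | (∀ t ∈ U, HasDerivAt X (f (X t)) t) ∧ X 0 = s}

/-- The guarded orbital of `f` with guard `G` on the time domain `U`:
state transformer semantics of the evolution command `x' = f & G on U`. -/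
def gorbital {n : ℕ} (f : EuclideanSpace ℝ (Fin n) → EuclideanSpace ℝ (Fin n))
    (G : EuclideanSpace ℝ (Fin n) → Prop) (U : Set ℝ)
    (s : EuclideanSpace ℝ (Fin n)) : Set (EuclideanSpace ℝ (Fin n)) :=
  {y | ∃ X ∈ Sols f U s, ∃ t ∈ U, (∀ τ ∈ U, τ ≤ t → G (X τ)) ∧ y = X t}

/-- Two solutions of an autonomous ODE with Lipschitz right-hand side that agree at one point of
an order-connected time domain agree on the whole domain. -/
theorem eqOn_of_hasDerivAt_of_lipschitzWith {E : Type*} [NormedAddCommGroup E] [NormedSpace ℝ E]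
    {f : E → E} {K : NNReal} (hf : LipschitzWith K f) {U : Set ℝ} (hU : U.OrdConnected)
    {X Y : ℝ → E} (hX : ∀ t ∈ U, HasDerivAt X (f (X t)) t)
    (hY : ∀ t ∈ U, HasDerivAt Y (f (Y t)) t) {t₀ : ℝ} (ht₀ : t₀ ∈ U) (h : X t₀ = Y t₀) :
    Set.EqOn X Y U := by
  intro t ht
  rcases le_total t₀ t with hle | hle
  · have hsub := hU.out ht₀ ht
    exact ODE_solution_unique (v := fun _ => f) (fun _ => hf)
      (HasDerivAt.continuousOn fun τ hτ => hX τ (hsub hτ))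
      (fun τ hτ => (hX τ (hsub (Set.Ico_subset_Icc_self hτ))).hasDerivWithinAt)
      (HasDerivAt.continuousOn fun τ hτ => hY τ (hsub hτ))
      (fun τ hτ => (hY τ (hsub (Set.Ico_subset_Icc_self hτ))).hasDerivWithinAt)
      h (Set.right_mem_Icc.2 hle)
  · have hsub := hU.out ht ht₀
    exact ODE_solution_unique_of_mem_Icc_left (v := fun _ => f) (s := fun _ => Set.univ)
      (fun _ _ => hf.lipschitzOnWith)
      (HasDerivAt.continuousOn fun τ hτ => hX τ (hsub hτ))
      (fun τ hτ => (hX τ (hsub (Set.Ioc_subset_Icc_self hτ))).hasDerivWithinAt)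
      (fun _ _ => Set.mem_univ _)
      (HasDerivAt.continuousOn fun τ hτ => hY τ (hsub hτ))
      (fun τ hτ => (hY τ (hsub (Set.Ioc_subset_Icc_self hτ))).hasDerivWithinAt)
      (fun _ _ => Set.mem_univ _) h (Set.left_mem_Icc.2 hle)

/-- Hoare rule for evolution commands (h-evl). -/
theorem hoare_evl {n : ℕ} (f : EuclideanSpace ℝ (Fin n) → EuclideanSpace ℝ (Fin n))
    (K : NNReal) (hf : LipschitzWith K f)
    (T : Set ℝ) (hT : IsOpen T) (hTc : T.OrdConnected) (hT0 : (0 : ℝ) ∈ T)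
    (φ : ℝ → EuclideanSpace ℝ (Fin n) → EuclideanSpace ℝ (Fin n))
    (hφ0 : ∀ s, φ 0 s = s)
    (hφ : ∀ s, ∀ t ∈ T, HasDerivAt (fun τ => φ τ s) (f (φ t s)) t)
    (U : Set ℝ) (hUT : U ⊆ T) (hU0 : (0 : ℝ) ∈ U) (hUc : U.OrdConnected)
    (G Q : EuclideanSpace ℝ (Fin n) → Prop) :
    hoare (fun s => ∀ t ∈ U, (∀ τ ∈ U, τ ≤ t → G (φ τ s)) → Q (φ t s))
      (gorbital f G U) Q := by
  rintro s hs _ ⟨X, ⟨hX, hX0⟩, t, ht, hG, rfl⟩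
  have hEq : ∀ τ ∈ U, X τ = φ τ s :=
    fun _ h => eqOn_of_hasDerivAt_of_lipschitzWith hf hUc hX (fun τ hτ => hφ s τ (hUT hτ))
      hU0 (hX0.trans (hφ0 s).symm) h
  change Q (X t)
  rw [hEq t ht]
  exact hs t ht fun τ hτ hτt => hEq τ hτ ▸ hG τ hτ hτt
end

section
/- Differential invariant rule for equalities: let E = EuclideanSpace ℝ (Fin n), f : E → E, let U ⊆ ℝ be an interval with 0 ∈ U, and let μ, ν : E → ℝ. Suppose that for every s ∈ E and every X ∈ Sols f U s there is a function d : ℝ → ℝ such that for all t ∈ U, both μ ∘ X and ν ∘ X have derivative d t at t (i.e. the derivatives of μ ∘ X and ν ∘ X agree along every solution). Then the predicate λ s, μ s = ν s is invariant: for every s with μ s = ν s, every X ∈ Sols f U s, every t ∈ U and any guard G : E → Prop, if G (X τ) holds for all τ ∈ U with τ ≤ t, then μ (X t) = ν (X t). -/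
/-- Differential invariant rule for equalities. -/
theorem diff_inv_eq {n : ℕ} (f : EuclideanSpace ℝ (Fin n) → EuclideanSpace ℝ (Fin n))
    (U : Set ℝ) (hUc : U.OrdConnected) (hU0 : (0 : ℝ) ∈ U)
    (μ ν : EuclideanSpace ℝ (Fin n) → ℝ)
    (hder : ∀ s : EuclideanSpace ℝ (Fin n), ∀ X ∈ Sols f U s, ∃ d : ℝ → ℝ,
      ∀ t ∈ U, HasDerivAt (μ ∘ X) (d t) t ∧ HasDerivAt (ν ∘ X) (d t) t) :
    ∀ s : EuclideanSpace ℝ (Fin n), μ s = ν s → ∀ X ∈ Sols f U s, ∀ t ∈ U,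
      ∀ G : EuclideanSpace ℝ (Fin n) → Prop,
        (∀ τ ∈ U, τ ≤ t → G (X τ)) → μ (X t) = ν (X t) := by
  intro s hs X hX t ht G _
  obtain ⟨d, hd⟩ := hder s X hX
  have hg : ∀ τ ∈ U, HasDerivWithinAt (μ ∘ X - ν ∘ X) 0 U τ := fun τ hτ => by
    simpa using ((hd τ hτ).1.sub (hd τ hτ).2).hasDerivWithinAt
  have h := hUc.convex.norm_image_sub_le_of_norm_hasDerivWithin_le (C := 0) hg
    (fun _ _ => norm_zero.le) hU0 ht
  rw [zero_mul, norm_le_zero_iff] at h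
  simpa [hX.2, hs, sub_eq_zero] using h
end

section
/- Differential invariant rule for strict inequalities: let E = EuclideanSpace ℝ (Fin n), f : E → E, let U ⊆ ℝ be an interval with 0 ∈ U, and let μ, ν : E → ℝ. Suppose that for every s ∈ E and every X ∈ Sols f U s there are functions dμ, dν : ℝ → ℝ such that for all t ∈ U, μ ∘ X has derivative dμ t at t and ν ∘ X has derivative dν t at t, with dμ t ≤ dν t whenever t ∈ U and t > 0, and dν t ≤ dμ t whenever t ∈ U and t < 0. Then the predicate λ s, μ s < ν s is invariant: for every s with μ s < ν s, every X ∈ Sols f U s, every t ∈ U and any guard G : E → Prop, if G (X τ) holds for all τ ∈ U with τ ≤ t, then μ (X t) < ν (X t). -/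
/-- Differential invariant rule for strict inequalities. -/
theorem diff_inv_lt {n : ℕ} (f : EuclideanSpace ℝ (Fin n) → EuclideanSpace ℝ (Fin n))
    (U : Set ℝ) (hUc : U.OrdConnected) (hU0 : (0 : ℝ) ∈ U)
    (μ ν : EuclideanSpace ℝ (Fin n) → ℝ)
    (hder : ∀ s : EuclideanSpace ℝ (Fin n), ∀ X ∈ Sols f U s, ∃ dμ dν : ℝ → ℝ,
      (∀ t ∈ U, HasDerivAt (μ ∘ X) (dμ t) t ∧ HasDerivAt (ν ∘ X) (dν t) t) ∧
      (∀ t ∈ U, 0 < t → dμ t ≤ dν t) ∧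
      (∀ t ∈ U, t < 0 → dν t ≤ dμ t)) :
    ∀ s : EuclideanSpace ℝ (Fin n), μ s < ν s → ∀ X ∈ Sols f U s, ∀ t ∈ U,
      ∀ G : EuclideanSpace ℝ (Fin n) → Prop,
        (∀ τ ∈ U, τ ≤ t → G (X τ)) → μ (X t) < ν (X t) := by
  intro s hs X hX t ht G _
  obtain ⟨dμ, dν, hd, hpos, hneg⟩ := hder s X hX
  have hdiff : ∀ τ ∈ U, HasDerivAt (fun τ => ν (X τ) - μ (X τ)) (dν τ - dμ τ) τ :=
    fun τ hτ => (hd τ hτ).2.sub (hd τ hτ).1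
  suffices h : ν (X 0) - μ (X 0) ≤ ν (X t) - μ (X t) by
    rw [hX.2] at h
    linarith
  rcases le_total 0 t with h0 | h0
  · have hsub : Set.Icc 0 t ⊆ U := hUc.out hU0 ht
    refine monotoneOn_of_hasDerivWithinAt_nonneg (convex_Icc 0 t)
      (fun τ hτ => (hdiff τ (hsub hτ)).continuousAt.continuousWithinAt)
      (fun τ hτ => (hdiff τ (hsub (interior_subset hτ))).hasDerivWithinAt)
      (fun τ hτ => ?_) (Set.left_mem_Icc.2 h0) (Set.right_mem_Icc.2 h0) h0
    have hU := hsub (interior_subset hτ)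
    rw [interior_Icc] at hτ
    exact sub_nonneg.2 (hpos τ hU hτ.1)
  · have hsub : Set.Icc t 0 ⊆ U := hUc.out ht hU0
    refine antitoneOn_of_hasDerivWithinAt_nonpos (convex_Icc t 0)
      (fun τ hτ => (hdiff τ (hsub hτ)).continuousAt.continuousWithinAt)
      (fun τ hτ => (hdiff τ (hsub (interior_subset hτ))).hasDerivWithinAt)
      (fun τ hτ => ?_) (Set.left_mem_Icc.2 h0) (Set.right_mem_Icc.2 h0) h0
    have hU := hsub (interior_subset hτ)
    rw [interior_Icc] at hτ
    exact sub_nonpos.2 (hneg τ hU hτ.2)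
end
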